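/- Let d₀ be a positive integer and let θ*, θ̄ ∈ B₁ satisfy ‖θ*‖₀ ≤ d₀ and ‖θ*‖₁ < 1. Let [θ̄]_{d₀} be a hard truncation of θ̄ keeping its d₀ largest-magnitude coordinates. Then D(θ*, [θ̄]_{d₀}) ≤ 2 √(2 d₀) ‖θ̄ − θ*‖₂ / (1 − ‖θ*‖₁). -/

import Mathlib

open Finset

/-- ℓ¹-norm on `Fin d → ℝ`. -/
noncomputable def l1 {d : ℕ} (x : Fin d → ℝ) : ℝ := ∑ i, |x i|

/-- Euclidean (ℓ²) norm on `Fin d → ℝ`. -/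
noncomputable def l2 {d : ℕ} (x : Fin d → ℝ) : ℝ := Real.sqrt (∑ i, (x i) ^ 2)

/-- ℓ⁰ "norm": number of nonzero coordinates. -/
noncomputable def l0 {d : ℕ} (x : Fin d → ℝ) : ℕ :=
  (Finset.univ.filter fun i => x i ≠ 0).card

/-- Averaging accelerability `D(θ, θ')`. -/
noncomputable def Dacc {d : ℕ} (θ θ' : Fin d → ℝ) : ℝ :=
  sInf {p : ℝ | p ∈ Set.Icc (0 : ℝ) 1 ∧ l1 (θ - (1 - p) • θ') ≤ p}

/-- `y` is a hard truncation of `x` keeping `k` coordinates of largest absolute value: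
`y` coincides with `x` on a set `S` of `k` coordinates where `|x i|` is largest and
vanishes elsewhere. -/
def IsHardTrunc {d : ℕ} (x : Fin d → ℝ) (k : ℕ) (y : Fin d → ℝ) : Prop :=
  ∃ S : Finset (Fin d), S.card = k ∧ (∀ i ∈ S, y i = x i) ∧ (∀ i ∉ S, y i = 0) ∧
    ∀ i ∈ S, ∀ j ∉ S, |x j| ≤ |x i|

/-- A finite sum is dominated by the sum over a set of at least as many elements,
each of whose values exceeds every value of the first sum. -/
theorem sum_le_sum_of_card_le_of_forall_le {ι : Type*} {A B : Finset ι} {f : ι → ℝ}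
    (hf : ∀ i, 0 ≤ f i) (hcard : A.card ≤ B.card)
    (h : ∀ i ∈ B, ∀ j ∈ A, f j ≤ f i) : ∑ j ∈ A, f j ≤ ∑ i ∈ B, f i := by
  rcases A.eq_empty_or_nonempty with rfl | hA
  · simpa using Finset.sum_nonneg fun i _ => hf i
  · obtain ⟨a, ha, hmax⟩ := A.exists_max_image f hA
    calc ∑ j ∈ A, f j ≤ A.card • f a := Finset.sum_le_card_nsmul _ _ _ hmax
      _ ≤ B.card • f a := nsmul_le_nsmul_left (hf a) hcard
      _ ≤ ∑ i ∈ B, f i := Finset.card_nsmul_le_sum _ _ _ fun i hi => h i hi a ha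

theorem l1_nonneg {d : ℕ} (x : Fin d → ℝ) : 0 ≤ l1 x :=
  Finset.sum_nonneg fun _ _ => abs_nonneg _

theorem l1_add_le {d : ℕ} (x y : Fin d → ℝ) : l1 (x + y) ≤ l1 x + l1 y := by
  unfold l1
  rw [← Finset.sum_add_distrib]
  exact Finset.sum_le_sum fun i _ => abs_add_le _ _

theorem l1_smul {d : ℕ} (c : ℝ) (x : Fin d → ℝ) : l1 (c • x) = |c| * l1 x := by
  simp [l1, abs_mul, Finset.mul_sum]

/-- Cauchy–Schwarz: the ℓ¹-mass of `x` on `U` is at most `√m ‖x‖₂` when `U` has at most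
`m` elements. -/
theorem sum_abs_le_sqrt_mul_l2 {d : ℕ} (x : Fin d → ℝ) (U : Finset (Fin d)) {m : ℝ}
    (hU : (U.card : ℝ) ≤ m) : ∑ i ∈ U, |x i| ≤ Real.sqrt m * l2 x := by
  have hsub : ∑ i ∈ U, x i ^ 2 ≤ ∑ i, x i ^ 2 :=
    Finset.sum_le_univ_sum_of_nonneg fun i => sq_nonneg _
  have hm : 0 ≤ m := (Nat.cast_nonneg _).trans hU
  rw [l2, ← Real.sqrt_mul hm]
  refine Real.le_sqrt_of_sq_le ?_
  calc (∑ i ∈ U, |x i|) ^ 2 ≤ U.card * ∑ i ∈ U, |x i| ^ 2 := sq_sum_le_card_mul_sum_sq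
    _ = U.card * ∑ i ∈ U, x i ^ 2 := by simp only [sq_abs]
    _ ≤ m * ∑ i, x i ^ 2 :=
      mul_le_mul hU hsub (Finset.sum_nonneg fun i _ => sq_nonneg _) hm

/-- Hard truncation to `k` coordinates is stable around `k`-sparse vectors. -/
theorem l1_sub_hardTrunc_le {d k : ℕ} {x y z : Fin d → ℝ} (hz : l0 z ≤ k)
    (hy : IsHardTrunc x k y) :
    l1 (z - y) ≤ 2 * Real.sqrt (2 * (k : ℝ)) * l2 (x - z) := by
  obtain ⟨S, hS, hyS, hyS', hmax⟩ := hy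
  set T : Finset (Fin d) := Finset.univ.filter fun i => z i ≠ 0 with hT
  have hTz : ∀ i ∉ T, z i = 0 := fun i hi => by simpa [hT] using hi
  have hTk : T.card ≤ S.card := hS ▸ hz
  have hunion : l1 (z - y) = ∑ i ∈ S ∪ T, |z i - y i| := by
    refine (Finset.sum_subset (Finset.subset_univ _) fun i _ hi => ?_).symm
    rw [Finset.mem_union, not_or] at hi
    simp [hTz i hi.2, hyS' i hi.1]
  have hsplit (f : Fin d → ℝ) : ∑ i ∈ S ∪ T, f i = ∑ i ∈ S, f i + ∑ i ∈ T \ S, f i := by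
    rw [← Finset.union_sdiff_self_eq_union, Finset.sum_union Finset.disjoint_sdiff]
  have hon : ∑ i ∈ S, |z i - y i| = ∑ i ∈ S, |(x - z) i| :=
    Finset.sum_congr rfl fun i hi => by rw [hyS i hi, abs_sub_comm, Pi.sub_apply]
  have hoff : ∑ i ∈ T \ S, |z i - y i| ≤ ∑ i ∈ T \ S, |(x - z) i| + ∑ i ∈ T \ S, |x i| := by
    rw [← Finset.sum_add_distrib]
    refine Finset.sum_le_sum fun i hi => ?_
    rw [hyS' i (Finset.mem_sdiff.1 hi).2, sub_zero, Pi.sub_apply, abs_sub_comm]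
    simpa using abs_add_le (z i - x i) (x i)
  have hswap : ∑ i ∈ T \ S, |x i| ≤ ∑ i ∈ S \ T, |x i| :=
    sum_le_sum_of_card_le_of_forall_le (fun i => abs_nonneg _)
      (Finset.card_sdiff_le_card_sdiff_iff.2 hTk)
      fun i hi j hj => hmax i (Finset.mem_sdiff.1 hi).1 j (Finset.mem_sdiff.1 hj).2
  have hdiff : ∑ i ∈ S \ T, |x i| ≤ ∑ i ∈ S ∪ T, |(x - z) i| := by
    calc ∑ i ∈ S \ T, |x i| = ∑ i ∈ S \ T, |(x - z) i| :=
          Finset.sum_congr rfl fun i hi => by simp [hTz i (Finset.mem_sdiff.1 hi).2]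
      _ ≤ _ := Finset.sum_le_sum_of_subset_of_nonneg
          (Finset.sdiff_subset.trans Finset.subset_union_left) fun i _ _ => abs_nonneg _
  have hcard : (((S ∪ T).card : ℕ) : ℝ) ≤ 2 * (k : ℝ) := by
    have := Finset.card_union_le S T
    exact_mod_cast (by omega : (S ∪ T).card ≤ 2 * k)
  have hcs := sum_abs_le_sqrt_mul_l2 (x - z) (S ∪ T) hcard
  have h₁ := hsplit fun i => |z i - y i|
  have h₂ := hsplit fun i => |(x - z) i|
  linarith

/-- Averaging accelerability at an interior point is controlled by the ℓ¹-distance. -/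
theorem Dacc_le_l1_sub_div {d : ℕ} {θ θ' : Fin d → ℝ} (hθ : l1 θ < 1) :
    Dacc θ θ' ≤ l1 (θ - θ') / (1 - l1 θ) := by
  have hgap : 0 < 1 - l1 θ := sub_pos.2 hθ
  have hδ := l1_nonneg (θ - θ')
  set δ := l1 (θ - θ') with hδdef
  have hden : 0 < 1 - l1 θ + δ := by positivity
  have hp0 : 0 ≤ δ / (1 - l1 θ + δ) := by positivity
  have hp1 : δ / (1 - l1 θ + δ) ≤ 1 := (div_le_one hden).2 (by linarith)
  have hbal : δ / (1 - l1 θ + δ) * (1 - l1 θ + δ) = δ := div_mul_cancel₀ _ hden.ne'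
  have hle : δ / (1 - l1 θ + δ) ≤ δ / (1 - l1 θ) :=
    div_le_div_of_nonneg_left hδ hgap (by linarith)
  refine le_trans (csInf_le ⟨0, fun p hp => hp.1.1⟩ ⟨⟨hp0, hp1⟩, ?_⟩) hle
  set p := δ / (1 - l1 θ + δ)
  have hdecomp : θ - (1 - p) • θ' = p • θ + (1 - p) • (θ - θ') := by module
  have htri := l1_add_le (p • θ) ((1 - p) • (θ - θ'))
  rw [← hdecomp, l1_smul, l1_smul, abs_of_nonneg hp0, abs_of_nonneg (sub_nonneg.2 hp1),
    ← hδdef] at htri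
  linarith

/-- The bound used in the induction step of the proof of Theorem 4 of the paper,
for optima with ℓ¹-norm strictly less than 1:
`D(θ*, [θ̄]_{d₀}) ≤ 2√(2d₀)‖θ̄ - θ*‖₂ / (1 - ‖θ*‖₁)`. -/
theorem Dacc_hardTrunc_interior_bound {d : ℕ} (d0 : ℕ) (hd0 : 0 < d0)
    (θstar θbar tr : Fin d → ℝ)
    (hstar1 : l1 θstar ≤ 1) (hbar1 : l1 θbar ≤ 1)
    (hstar0 : l0 θstar ≤ d0) (hstarlt : l1 θstar < 1)
    (htr : IsHardTrunc θbar d0 tr) :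
    Dacc θstar tr ≤ 2 * Real.sqrt (2 * (d0 : ℝ)) * l2 (θbar - θstar) / (1 - l1 θstar) := by
  exact Dacc_le_l1_sub_div hstarlt |>.trans <|
    div_le_div_of_nonneg_right (l1_sub_hardTrunc_le hstar0 htr) (sub_pos.2 hstarlt).le
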